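/- There is no data set of type A of genus 4; that is, there are no integers n, g₀, m, a, b, c₁,…,c_m, n₁,…,n_m satisfying conditions (D1), (D2), (D3A) with g₀·n + Σ_{i=1}^m (n/n_i)(n_i − 1) = 4. -/

import Mathlib

/-- A data set of type A (degree `n`), as in Parlak–Stukow:
conditions (D1), (D2), (D3A). -/
structure DataSetA where
  n : ℤ
  g0 : ℤ
  a : ℤ
  b : ℤ
  m : ℕ
  c : Fin m → ℤ
  ni : Fin m → ℤ
  /-- (D1): `n > 1` is odd -/
  n_gt_one : 1 < n
  n_odd : Odd n
  /-- (D1): each `nᵢ > 1` -/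
  ni_gt_one : ∀ i, 1 < ni i
  /-- (D1): each `nᵢ` divides `n` -/
  ni_dvd : ∀ i, ni i ∣ n
  /-- (D2) -/
  gcd_a : Int.gcd a n = 1
  gcd_b : Int.gcd b n = 1
  gcd_c : ∀ i, Int.gcd (c i) (ni i) = 1
  /-- (D3A): `g₀ ≥ 1` -/
  g0_pos : 1 ≤ g0
  /-- (D3A): `b ± a = ab mod n` -/
  D3A : b + a ≡ a * b [ZMOD n] ∨ b - a ≡ a * b [ZMOD n]

/-- The genus of a type A data set: `g = g₀·n + Σᵢ (n/nᵢ)(nᵢ − 1)`. -/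
def DataSetA.genus (D : DataSetA) : ℤ :=
  D.g0 * D.n + ∑ i, (D.n / D.ni i) * (D.ni i - 1)

/-- There is no data set of type A of genus 4. -/
theorem no_typeA_genus_four : ¬ ∃ D : DataSetA, D.genus = 4 := by
  rintro ⟨D, hD⟩
  unfold DataSetA.genus at hD
  have hn := D.n_gt_one
  have hg := D.g0_pos
  have hodd := D.n_odd
  have heven : Even (∑ i, (D.n / D.ni i) * (D.ni i - 1)) := by
    refine Finset.even_sum _ fun i _ => ?_
    have hni : Odd (D.ni i) := by
      obtain ⟨k, hk⟩ := D.ni_dvd i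
      exact (Int.odd_mul.mp (hk ▸ hodd)).1
    exact (hni.sub_odd odd_one).mul_left _
  have hnonneg : 0 ≤ ∑ i, (D.n / D.ni i) * (D.ni i - 1) := by
    refine Finset.sum_nonneg fun i _ => ?_
    have hni := D.ni_gt_one i
    exact mul_nonneg (Int.ediv_nonneg (by lia) (by lia)) (by lia)
  have hprod : Even (D.g0 * D.n) := by
    rw [eq_sub_of_add_eq hD]
    exact Even.sub (by decide) heven
  obtain ⟨k, hk⟩ : Even D.g0 :=
    (Int.even_mul.mp hprod).resolve_right (Int.not_even_iff_odd.mpr hodd)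
  obtain ⟨l, hl⟩ := hodd
  nlinarith [mul_le_mul (show 2 ≤ D.g0 by lia) (show 3 ≤ D.n by lia) (by lia) (by lia)]
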